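/- For a weakly C(4) finite monoid presentation ⟨A | R⟩: suppose a word u has clean overlap prefix wXY, where XYZ is a relation word with maximal piece prefix X, middle word Y and maximal piece suffix Z. If u ≡ v, then v has overlap prefix wX̄Ȳ for some complement X̄ȲZ̄ of XYZ, and no relation word occurring as a factor of v overlaps this prefix wX̄Ȳ, unless that factor is X̄ȲZ̄ occurring in the obvious place (i.e. v = w·X̄·Ȳ·Z̄·v′ with the factor being this occurrence of X̄ȲZ̄). -/

import Mathlib

open List

/-- A *relation word* is a word occurring as one side of some relation in `R`. -/
def RelWord {A : Type*} (R : Finset (List A × List A)) (w : List A) : Prop :=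
  ∃ p ∈ R, w = p.1 ∨ w = p.2

/-- One elementary rewriting step using a defining relation (in either direction). -/
def OneStep {A : Type*} (R : Finset (List A × List A)) (u v : List A) : Prop :=
  ∃ l r x y, ((x, y) ∈ R ∨ (y, x) ∈ R) ∧ u = l ++ x ++ r ∧ v = l ++ y ++ r

/-- `u ≡ v`: the congruence on the free monoid `A*` generated by the relations `R`. -/
def MEquiv {A : Type*} (R : Finset (List A × List A)) : List A → List A → Prop :=
  Relation.ReflTransGen (OneStep R)

/-- A *piece*: a word occurring as a factor of two distinct relation words, or in two
different (possibly overlapping) positions within one relation word.  The empty word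
is a piece. -/
def Piece {A : Type*} (R : Finset (List A × List A)) (p : List A) : Prop :=
  p = [] ∨ ∃ r₁ r₂ a₁ b₁ a₂ b₂, RelWord R r₁ ∧ RelWord R r₂ ∧
    r₁ = a₁ ++ p ++ b₁ ∧ r₂ = a₂ ++ p ++ b₂ ∧ (r₁ ≠ r₂ ∨ a₁ ≠ a₂)

/-- Weakly `C(n)`: no relation word is a product of strictly fewer than `n` pieces. -/
def WeaklyC {A : Type*} (R : Finset (List A × List A)) (n : ℕ) : Prop :=
  ∀ w, RelWord R w → ∀ L : List (List A), (∀ p ∈ L, Piece R p) → w = L.flatten →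
    n ≤ L.length

/-- `X` is the maximal (longest) prefix of `r` which is a piece. -/
def MaxPiecePrefix {A : Type*} (R : Finset (List A × List A)) (r X : List A) : Prop :=
  X <+: r ∧ Piece R X ∧ ∀ p, p <+: r → Piece R p → p.length ≤ X.length

/-- `Z` is the maximal (longest) suffix of `r` which is a piece. -/
def MaxPieceSuffix {A : Type*} (R : Finset (List A × List A)) (r Z : List A) : Prop :=
  Z <:+ r ∧ Piece R Z ∧ ∀ s, s <:+ r → Piece R s → s.length ≤ Z.length

/-- `X ++ Y ++ Z` is a relation word with maximal piece prefix `X`, middle word `Y`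
and maximal piece suffix `Z`. -/
def RelDecomp {A : Type*} (R : Finset (List A × List A)) (X Y Z : List A) : Prop :=
  RelWord R (X ++ Y ++ Z) ∧ MaxPiecePrefix R (X ++ Y ++ Z) X ∧
    MaxPieceSuffix R (X ++ Y ++ Z) Z

/-- `q` is a relation prefix of `u`: a prefix of the form `a ++ X ++ Y` where `X`, `Y`
are the maximal piece prefix and middle word of some relation word `X ++ Y ++ Z`. -/
def RelPrefix {A : Type*} (R : Finset (List A × List A)) (u q : List A) : Prop :=
  q <+: u ∧ ∃ a X Y Z, q = a ++ X ++ Y ∧ RelDecomp R X Y Z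

/-- `a ++ X ++ Y` is an overlap prefix of `u`, with final maximal piece prefix `X` and
middle word `Y`, i.e. it admits a factorisation `b X₁ Y₁' ⋯ X_{n-1} Y_{n-1}' X_n Y_n`
with `X = X_n`, `Y = Y_n`, no factor `X₀ Y₀` beginning strictly before the end of `b`,
each `X_i Y_i Z_i` a relation word factored into maximal piece prefix, middle word and
maximal piece suffix, and each `Y_i'` (`i < n`) a proper non-empty prefix of `Y_i`. -/
def OPrefix {A : Type*} (R : Finset (List A × List A)) (u a X Y : List A) : Prop :=
  (a ++ X ++ Y) <+: u ∧
  ∃ (b : List A) (n : ℕ) (Xs Ys Zs Ys' : ℕ → List A),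
    1 ≤ n ∧ Xs (n - 1) = X ∧ Ys (n - 1) = Y ∧
    a = b ++ ((List.range (n - 1)).map fun i => Xs i ++ Ys' i).flatten ∧
    (∀ i < n, RelDecomp R (Xs i) (Ys i) (Zs i)) ∧
    (∀ i < n - 1, Ys' i ≠ [] ∧ Ys' i <+: Ys i ∧ Ys' i ≠ Ys i) ∧
    ¬ ∃ c d X₀ Y₀ Z₀, RelDecomp R X₀ Y₀ Z₀ ∧
        a ++ X ++ Y = c ++ X₀ ++ Y₀ ++ d ∧ c.length < b.length

/-- The relation prefix `a ++ X ++ Y` of `u` is *clean*: `u` has no prefix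
`a ++ X ++ Y₀ ++ X₁ ++ Y₁` with `Y₀` a proper non-empty prefix of `Y` and `X₁`, `Y₁`
the maximal piece prefix and middle word of some relation word. -/
def CleanAt {A : Type*} (R : Finset (List A × List A)) (u a X Y : List A) : Prop :=
  ¬ ∃ Y₀ X₁ Y₁ Z₁, RelDecomp R X₁ Y₁ Z₁ ∧ Y₀ ≠ [] ∧ Y₀ <+: Y ∧ Y₀ ≠ Y ∧
      (a ++ X ++ Y₀ ++ X₁ ++ Y₁) <+: u

/-- `a ++ X ++ Y` is a clean overlap prefix of `u`, where `X ++ Y ++ Z` is a relation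
word with maximal piece prefix `X`, middle word `Y` and maximal piece suffix `Z`. -/
def CleanOverlapPrefix {A : Type*} (R : Finset (List A × List A))
    (u a X Y Z : List A) : Prop :=
  RelDecomp R X Y Z ∧ OPrefix R u a X Y ∧ CleanAt R u a X Y

/-- `r'` is a complement of the relation word `r`: there is a chain of relation words
from `r` to `r'` each consecutive pair of which forms a relation (in some order). -/
def RelComplement {A : Type*} (R : Finset (List A × List A)) (r r' : List A) : Prop :=
  RelWord R r ∧ Relation.ReflTransGen (fun s t => (s, t) ∈ R ∨ (t, s) ∈ R) r r'

/-- `u` is `p`-active: `p ++ u` has a relation prefix `a ++ X ++ Y` with `|a| < |p|`. -/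
def PActive {A : Type*} (R : Finset (List A × List A)) (p u : List A) : Prop :=
  ∃ a X Y Z, RelDecomp R X Y Z ∧ (a ++ X ++ Y) <+: (p ++ u) ∧ a.length < p.length

/-- `p` is a possible prefix of `u`: `p ++ w ≡ u` for some word `w`. -/
def PossPrefix {A : Type*} (R : Finset (List A × List A)) (p u : List A) : Prop :=
  ∃ w, MEquiv R (p ++ w) u

/-- The word `g` occurs in `u` at position `p`. -/
def OccursAt {A : Type*} (u : List A) (p : ℕ) (g : List A) : Prop :=
  g <+: u.drop p

theorem OccursAt.mono {A : Type*} {u g h : List A} {p : ℕ} (hu : OccursAt u p g)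
    (hh : h <+: g) : OccursAt u p h :=
  hh.trans hu

theorem occursAt_of_eq {A : Type*} {u s r t : List A} (h : u = s ++ r ++ t) :
    OccursAt u s.length r := by
  subst h
  simp [OccursAt]

theorem occursAt_of_isPrefix {A : Type*} {u s r : List A} (h : s ++ r <+: u) :
    OccursAt u s.length r := by
  obtain ⟨t, ht⟩ := h
  exact occursAt_of_eq ht.symm

theorem OccursAt.append_isPrefix {A : Type*} {u s r : List A} (hs : s <+: u)
    (h : OccursAt u s.length r) : s ++ r <+: u := by
  obtain ⟨t, rfl⟩ := hs
  simpa [OccursAt] using h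

/-- An occurrence ending within a common prefix of two words occurs in both. -/
theorem OccursAt.of_common_isPrefix {A : Type*} {u v c g : List A} {p : ℕ}
    (h : OccursAt u p g) (hu : c <+: u) (hv : c <+: v) (hp : p + g.length ≤ c.length) :
    OccursAt v p g := by
  obtain ⟨s, rfl⟩ := hu
  obtain ⟨t, rfl⟩ := hv
  unfold OccursAt at *
  rw [List.drop_append_of_le_length (by omega)] at *
  have : g <+: c.drop p :=
    List.prefix_of_prefix_length_le h (List.prefix_append _ _) (by simp; omega)
  exact this.trans (List.prefix_append _ _)

/-- A window inside an occurrence of a prefix of `r` is the corresponding window of `r`. -/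
theorem OccursAt.window_eq {A : Type*} {u g r : List A} {p q e : ℕ} (h : OccursAt u p g)
    (hg : g <+: r) (hpq : p ≤ q) (he : e ≤ p + g.length) :
    (u.drop q).take (e - q) = (r.drop (q - p)).take (e - q) := by
  obtain ⟨t, ht⟩ := h
  obtain ⟨s, rfl⟩ := hg
  have : u.drop q = (u.drop p).drop (q - p) := by
    rw [List.drop_drop]; congr 1; omega
  rw [this, ← ht]
  by_cases hq : q < e
  · rw [List.drop_append_of_le_length (by omega), List.drop_append_of_le_length (by omega),
      List.take_append_of_le_length (by simp; omega),
      List.take_append_of_le_length (by simp; omega)]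
  · simp [show e - q = 0 by omega]

section Pieces

variable {A : Type*} {R : Finset (List A × List A)}

theorem Piece.factor {a p b : List A} (h : Piece R (a ++ p ++ b)) : Piece R p := by
  rcases h with h | ⟨r₁, r₂, a₁, b₁, a₂, b₂, h₁, h₂, e₁, e₂, hne⟩
  · left; simp at h; exact h.2.1
  · right
    refine ⟨r₁, r₂, a₁ ++ a, b ++ b₁, a₂ ++ a, b ++ b₂, h₁, h₂, by simp [e₁], by simp [e₂], ?_⟩
    simpa using hne

/-- The overlap of two distinct occurrences of (prefixes of) relation words is a piece. -/
theorem piece_window {u g₁ r₁ g₂ r₂ : List A} {p₁ p₂ q e : ℕ}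
    (hr₁ : RelWord R r₁) (hr₂ : RelWord R r₂) (hg₁ : g₁ <+: r₁) (hg₂ : g₂ <+: r₂)
    (h₁ : OccursAt u p₁ g₁) (h₂ : OccursAt u p₂ g₂) (hne : r₁ ≠ r₂ ∨ p₁ ≠ p₂)
    (hq₁ : p₁ ≤ q) (hq₂ : p₂ ≤ q) (he₁ : e ≤ p₁ + g₁.length) (he₂ : e ≤ p₂ + g₂.length) :
    Piece R ((u.drop q).take (e - q)) := by
  by_cases hqe : q < e
  · have hl₁ := hg₁.length_le
    have hl₂ := hg₂.length_le
    have split : ∀ (r : List A) (k l : ℕ),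
        r = r.take k ++ (r.drop k).take l ++ (r.drop k).drop l := by
      intro r k l
      simp
    refine Or.inr ⟨r₁, r₂, r₁.take (q - p₁), (r₁.drop (q - p₁)).drop (e - q),
      r₂.take (q - p₂), (r₂.drop (q - p₂)).drop (e - q), hr₁, hr₂, ?_, ?_, ?_⟩
    · rw [h₁.window_eq hg₁ hq₁ he₁]; exact split _ _ _
    · rw [h₂.window_eq hg₂ hq₂ he₂]; exact split _ _ _
    · refine hne.imp id fun hp heq => hp ?_
      have := congrArg List.length heq
      simp only [List.length_take] at this
      omega
  · left; simp [show e - q = 0 by omega]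

theorem RelDecomp.not_piece_middle (hC : WeaklyC R 4) {X Y Z : List A}
    (h : RelDecomp R X Y Z) : ¬ Piece R Y := by
  intro hY
  have := hC _ h.1 [X, Y, Z] (by simp [hY, h.2.1.2.1, h.2.2.2.1]) (by simp)
  simp at this

theorem RelDecomp.middle_ne_nil (hC : WeaklyC R 4) {X Y Z : List A}
    (h : RelDecomp R X Y Z) : Y ≠ [] :=
  fun hY => h.not_piece_middle hC (Or.inl hY)

theorem RelDecomp.length_lt (hC : WeaklyC R 4) {X Y Z : List A} (h : RelDecomp R X Y Z) :
    X.length < (X ++ Y).length := by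
  have := List.length_pos_of_ne_nil (h.middle_ne_nil hC)
  simp only [List.length_append]
  omega

theorem RelWord.not_append_piece (hC : WeaklyC R 4) {r p q : List A} (hr : RelWord R r)
    (h : r = p ++ q) (hp : Piece R p) (hq : Piece R q) : False := by
  have := hC _ hr [p, q] (by simp [hp, hq]) (by simp [h])
  simp at this

theorem RelWord.exists_relDecomp (hC : WeaklyC R 4) {r : List A} (hr : RelWord R r) :
    ∃ X Y Z, r = X ++ Y ++ Z ∧ RelDecomp R X Y Z := by
  classical
  set P : ℕ → Prop := fun k => Piece R (r.take k) with hP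
  set Q : ℕ → Prop := fun k => Piece R (r.drop (r.length - k)) with hQ
  set k := Nat.findGreatest P r.length with hk
  set j := Nat.findGreatest Q r.length with hj
  have hPk : P k := Nat.findGreatest_spec (m := 0) (Nat.zero_le _) (Or.inl (by simp))
  have hQj : Q j := Nat.findGreatest_spec (m := 0) (Nat.zero_le _) (Or.inl (by simp))
  have hkj : k + j < r.length := by
    by_contra! hle
    have hs : Piece R (r.drop k) := by
      have : r.drop (r.length - j) =
          (r.drop (r.length - j)).take (k - (r.length - j)) ++ r.drop k ++ [] := by
        have h2 : r.drop k = (r.drop (r.length - j)).drop (k - (r.length - j)) := by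
          rw [List.drop_drop]; congr 1; omega
        rw [h2]; simp only [List.append_nil, List.take_append_drop]
      simp only [hQ] at hQj
      rw [this] at hQj
      exact hQj.factor
    exact hr.not_append_piece hC (List.take_append_drop k r).symm hPk hs
  have e : r = r.take k ++ (r.drop k).take (r.length - j - k) ++ r.drop (r.length - j) := by
    have h2 : r.drop (r.length - j) = (r.drop k).drop (r.length - j - k) := by
      rw [List.drop_drop]; congr 1; omega
    rw [h2, List.append_assoc, List.take_append_drop, List.take_append_drop]
  refine ⟨_, _, _, e, ?_⟩
  unfold RelDecomp MaxPiecePrefix MaxPieceSuffix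
  rw [← e]
  refine ⟨hr, ⟨List.take_prefix _ _, hPk, ?_⟩, List.drop_suffix _ _, hQj, ?_⟩
  · intro p hp hpp
    have : p.length ≤ k := Nat.le_findGreatest hp.length_le (by
      simp only [hP]; rw [← List.prefix_iff_eq_take.1 hp]; exact hpp)
    simp only [List.length_take]
    have := hp.length_le
    omega
  · intro p hp hpp
    have : p.length ≤ j := Nat.le_findGreatest hp.length_le (by
      simp only [hQ]; rw [← List.suffix_iff_eq_drop.1 hp]; exact hpp)
    simp only [List.length_drop]
    have := hp.length_le
    omega

/-- A prefix of a relation word extending beyond its maximal piece prefix only occurs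
inside (a prefix of) a relation word in the obvious place. -/
theorem RelDecomp.eq_of_occursAt {X Y Z u g₁ g₂ r : List A} {p₁ p₂ : ℕ}
    (hd : RelDecomp R X Y Z) (hr : RelWord R r) (hg₁ : g₁ <+: X ++ Y ++ Z) (hg₂ : g₂ <+: r)
    (h₁ : OccursAt u p₁ g₁) (h₂ : OccursAt u p₂ g₂) (hX : X.length < g₁.length)
    (hp : p₂ ≤ p₁) (he : p₁ + g₁.length ≤ p₂ + g₂.length) :
    X ++ Y ++ Z = r ∧ p₁ = p₂ := by
  by_contra hne
  rw [not_and_or] at hne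
  have hpc := piece_window hd.1 hr hg₁ hg₂ h₁ h₂ hne le_rfl hp le_rfl he
  rw [h₁.window_eq hg₁ le_rfl le_rfl] at hpc
  have := hd.2.1.2.2 _ (by simpa using List.take_prefix _ _) hpc
  have := hg₁.length_le
  simp only [List.length_take, List.length_drop] at *
  omega

/-- A relation word occurring inside (a prefix of) a relation word is the obvious one. -/
theorem RelWord.eq_of_occursAt (hC : WeaklyC R 4) {u g r r' : List A} {p p' : ℕ}
    (hr : RelWord R r) (hr' : RelWord R r') (hg : g <+: r') (h : OccursAt u p r)
    (h' : OccursAt u p' g) (hp : p' ≤ p) (he : p + r.length ≤ p' + g.length) :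
    r = r' ∧ p = p' := by
  obtain ⟨X, Y, Z, rfl, hd⟩ := hr.exists_relDecomp hC
  have := hd.length_lt hC
  exact hd.eq_of_occursAt hr' (List.prefix_refl _) hg h h' (by simp at *; omega) hp he

/-- Words `b X₁ Y₁' ⋯ Xₙ Yₙ'`, each `Yᵢ'` being a proper nonempty prefix of the middle
word `Yᵢ` of a relation word `Xᵢ Yᵢ Zᵢ`. -/
inductive OverlapChain (R : Finset (List A × List A)) (b : List A) : List A → Prop
  | base : OverlapChain R b b
  | step {w X Y Z Y₀ : List A} : OverlapChain R b w → RelDecomp R X Y Z → Y₀ ≠ [] →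
      Y₀ <+: Y → Y₀ ≠ Y → OverlapChain R b (w ++ X ++ Y₀)

/-- Every occurrence in `u` of a maximal piece prefix followed by the middle word of the
same relation word begins at position `k` or later. -/
def NoneBefore (R : Finset (List A × List A)) (u : List A) (k : ℕ) : Prop :=
  ∀ c X Y Z, RelDecomp R X Y Z → OccursAt u c (X ++ Y) → k ≤ c

theorem OverlapChain.isPrefix {b w : List A} (h : OverlapChain R b w) : b <+: w := by
  induction h with
  | base => exact List.prefix_refl _
  | step _ _ _ _ _ ih =>
    rw [List.append_assoc]
    exact ih.trans (List.prefix_append _ _)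

theorem OverlapChain.first {b w : List A} (h : OverlapChain R b w) :
    w = b ∨ ∃ X Y Z Y', RelDecomp R X Y Z ∧ Y' ≠ [] ∧ Y' <+: Y ∧ b ++ (X ++ Y') <+: w := by
  induction h with
  | base => exact Or.inl rfl
  | step _ hd hne hpre _ ih =>
    right
    rcases ih with rfl | ⟨X', Y', Z', Y'', hd', hne', hpre', hw⟩
    · exact ⟨_, _, _, _, hd, hne, hpre, by simp⟩
    · refine ⟨_, _, _, _, hd', hne', hpre', hw.trans ?_⟩
      rw [List.append_assoc]
      exact List.prefix_append _ _

theorem overlapChain_of_range {b : List A} (m : ℕ) (Xs Ys Zs Ys' : ℕ → List A)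
    (hd : ∀ i < m, RelDecomp R (Xs i) (Ys i) (Zs i))
    (hY : ∀ i < m, Ys' i ≠ [] ∧ Ys' i <+: Ys i ∧ Ys' i ≠ Ys i) :
    OverlapChain R b (b ++ ((List.range m).map fun i => Xs i ++ Ys' i).flatten) := by
  induction m with
  | zero => simpa using OverlapChain.base
  | succ m ih =>
    have h := ih (fun i hi => hd i (by omega)) (fun i hi => hY i (by omega))
    obtain ⟨h1, h2, h3⟩ := hY m (by omega)
    simpa [List.range_succ] using h.step (hd m (by omega)) h1 h2 h3

theorem OverlapChain.exists_range {b w : List A} (h : OverlapChain R b w) :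
    ∃ (m : ℕ) (Xs Ys Zs Ys' : ℕ → List A),
      w = b ++ ((List.range m).map fun i => Xs i ++ Ys' i).flatten ∧
      (∀ i < m, RelDecomp R (Xs i) (Ys i) (Zs i)) ∧
      (∀ i < m, Ys' i ≠ [] ∧ Ys' i <+: Ys i ∧ Ys' i ≠ Ys i) := by
  induction h with
  | base => exact ⟨0, fun _ => [], fun _ => [], fun _ => [], fun _ => [], by simp⟩
  | @step w X Y Z Y' _ hd hne hpre hpr ih =>
    obtain ⟨m, Xs, Ys, Zs, Ys', rfl, h1, h2⟩ := ih
    have key : ∀ (f : ℕ → List A) (x : List A) (i : ℕ), i < m →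
        Function.update f m x i = f i := fun f x i hi => Function.update_of_ne (by omega) _ _
    refine ⟨m + 1, Function.update Xs m X, Function.update Ys m Y, Function.update Zs m Z,
      Function.update Ys' m Y', ?_, ?_, ?_⟩
    · rw [List.range_succ, List.map_append, List.flatten_append, List.append_assoc,
        List.append_assoc]
      congr 1
      congr 1
      · congr 1
        apply List.map_congr_left
        intro i hi
        rw [key _ _ _ (List.mem_range.1 hi), key _ _ _ (List.mem_range.1 hi)]
      · simp
    · intro i hi
      rcases Nat.lt_succ_iff_lt_or_eq.1 hi with hi | rfl
      · simpa only [key _ _ _ hi] using h1 i hi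
      · simpa using hd
    · intro i hi
      rcases Nat.lt_succ_iff_lt_or_eq.1 hi with hi | rfl
      · simpa only [key _ _ _ hi] using h2 i hi
      · simpa using ⟨hne, hpre, hpr⟩

theorem OPrefix.exists_chain (hC : WeaklyC R 4) {u w X Y Z : List A}
    (hd : RelDecomp R X Y Z) (h : OPrefix R u w X Y) :
    ∃ b, OverlapChain R b w ∧ NoneBefore R u b.length := by
  obtain ⟨hu, b, n, Xs, Ys, Zs, Ys', hn, -, -, hw, h1, h2, h3⟩ := h
  have hch : OverlapChain R b w := by
    rw [hw]
    exact overlapChain_of_range _ Xs Ys Zs Ys' (fun i hi => h1 i (by omega)) h2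
  refine ⟨b, hch, fun c X₀ Y₀ Z₀ hd₀ hc => ?_⟩
  by_contra! hlt
  have hbw := hch.isPrefix.length_le
  rw [List.append_assoc] at hu
  by_cases hle : c + (X₀ ++ Y₀).length ≤ (w ++ (X ++ Y)).length
  · obtain ⟨t, ht⟩ := hc.of_common_isPrefix hu (List.prefix_refl _) hle
    refine h3 ⟨(w ++ (X ++ Y)).take c, t, X₀, Y₀, Z₀, hd₀, ?_, ?_⟩
    · simp only [List.append_assoc] at ht ⊢
      rw [ht, List.take_append_drop]
    · simp only [List.length_take]; omega
  · have := hd.eq_of_occursAt hd₀.1 (List.prefix_append _ _) (List.prefix_append _ _)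
      (occursAt_of_isPrefix hu) hc (hd.length_lt hC) (by omega)
      (by simp only [List.length_append] at *; omega)
    omega

theorem OverlapChain.oprefix {u b w X Y Z : List A} (h : OverlapChain R b w)
    (hd : RelDecomp R X Y Z) (hu : w ++ X ++ Y <+: u) (hb : NoneBefore R u b.length) :
    OPrefix R u w X Y := by
  obtain ⟨m, Xs, Ys, Zs, Ys', hw, h1, h2⟩ := h.exists_range
  have key : ∀ (f : ℕ → List A) (x : List A) (i : ℕ), i < m →
      Function.update f m x i = f i := fun f x i hi => Function.update_of_ne (by omega) _ _
  refine ⟨hu, b, m + 1, Function.update Xs m X, Function.update Ys m Y,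
    Function.update Zs m Z, Ys', by omega, by simp, by simp, ?_, ?_, ?_, ?_⟩
  · rw [hw, Nat.add_sub_cancel]
    congr 2
    apply List.map_congr_left
    intro i hi
    rw [key _ _ _ (List.mem_range.1 hi)]
  · intro i hi
    rcases Nat.lt_succ_iff_lt_or_eq.1 hi with hi | rfl
    · simpa only [key _ _ _ hi] using h1 i hi
    · simpa using hd
  · intro i hi
    simpa only [key _ _ _ hi] using h2 i hi
  · rintro ⟨c, d, X₀, Y₀, Z₀, hd₀, he, hlt⟩
    obtain ⟨t, rfl⟩ := hu
    have := hb c.length X₀ Y₀ Z₀ hd₀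
      (occursAt_of_eq (t := d ++ t) (by rw [he]; simp))
    omega

/-- No relation word begins before the last block of an overlap chain. -/
theorem OverlapChain.not_occursAt (hC : WeaklyC R 4) {u b w : List A}
    (h : OverlapChain R b w) (hb : NoneBefore R u b.length) :
    ∀ {g X Y Z : List A}, RelDecomp R X Y Z → g <+: X ++ Y ++ Z → X.length < g.length →
      w ++ g <+: u → ∀ {p : ℕ} {r : List A}, p < w.length → RelWord R r →
        ¬ OccursAt u p r := by
  induction h with
  | base =>
    intro g X Y Z _ _ _ _ p r hp hr hocc
    obtain ⟨X₀, Y₀, Z₀, rfl, hd₀⟩ := hr.exists_relDecomp hC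
    have := hb p X₀ Y₀ Z₀ hd₀ (hocc.mono (List.prefix_append _ _))
    omega
  | @step w X₁ Y₁ Z₁ Y' _ hd₁ hne hpre hpr ih =>
    intro g X Y Z hd hg hX hu p r hp hr hocc
    have hg₁ : X₁ ++ Y' <+: X₁ ++ Y₁ ++ Z₁ := by
      rw [List.append_assoc, List.prefix_append_right_inj]
      exact hpre.trans (List.prefix_append _ _)
    have hlY := List.length_pos_of_ne_nil hne
    have hX₁ : X₁.length < (X₁ ++ Y').length := by simp; omega
    have hu₁ : w ++ (X₁ ++ Y') <+: u := by
      rw [← List.append_assoc]; exact (List.prefix_append _ _).trans hu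
    have hwp : w.length ≤ p := by
      by_contra! hlt
      exact ih hd₁ hg₁ hX₁ hu₁ hlt hr hocc
    have ho₁ := occursAt_of_isPrefix hu₁
    have ho := occursAt_of_isPrefix hu
    have hend : p + r.length < (w ++ X₁ ++ Y').length + g.length := by
      by_contra! hle
      have := hd.eq_of_occursAt hr hg (List.prefix_refl _) ho hocc hX (by omega) hle
      omega
    have hlt : Y'.length < Y₁.length :=
      lt_of_le_of_ne hpre.length_le fun h => hpr (hpre.eq_of_length h)
    simp only [List.length_append] at hp hend hX₁
    rcases hwp.eq_or_lt with rfl | hwp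
    · have hre : r = X₁ ++ Y₁ ++ Z₁ := by
        by_cases hle : r.length ≤ (X₁ ++ Y').length
        · exact (hr.eq_of_occursAt hC hd₁.1 hg₁ hocc ho₁ le_rfl (by omega)).1
        · exact (hd₁.eq_of_occursAt hr hg₁ (List.prefix_refl _) ho₁ hocc
            (by simp; omega) le_rfl (by omega)).1.symm
      subst hre
      simp only [List.length_append] at hend
      have hpc := piece_window (q := (w ++ X₁ ++ Y').length)
        (e := w.length + (X₁ ++ Y₁ ++ Z₁).length) hr hd.1 (List.prefix_refl _) hg hocc ho
        (Or.inr (by simp only [List.length_append]; omega))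
        (by simp only [List.length_append]; omega) le_rfl le_rfl
        (by simp only [List.length_append]; omega)
      rw [hocc.window_eq (List.prefix_refl _) (by simp only [List.length_append]; omega)
        le_rfl] at hpc
      rw [List.take_of_length_le (by
        simp only [List.length_drop, List.length_append]; omega)] at hpc
      have := hd₁.2.2.2.2 _ (List.drop_suffix _ _) hpc
      simp only [List.length_drop, List.length_append] at this
      omega
    · by_cases hle : p + r.length ≤ w.length + (X₁ ++ Y').length
      · have := (hr.eq_of_occursAt hC hd₁.1 hg₁ hocc ho₁ hwp.le hle).2
        omega
      · simp only [List.length_append] at hle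
        have hp₁ := piece_window (q := p) (e := (w ++ X₁ ++ Y').length) hr hd₁.1
          (List.prefix_refl _) hg₁ hocc ho₁ (Or.inr (by omega)) le_rfl hwp.le
          (by simp only [List.length_append]; omega)
          (by simp only [List.length_append]; omega)
        have hp₂ := piece_window (q := (w ++ X₁ ++ Y').length) (e := p + r.length) hr hd.1
          (List.prefix_refl _) hg hocc ho
          (Or.inr (by simp only [List.length_append]; omega))
          (by simp only [List.length_append]; omega) le_rfl le_rfl
          (by simp only [List.length_append]; omega)
        rw [hocc.window_eq (List.prefix_refl _) le_rfl
          (by simp only [List.length_append]; omega), Nat.sub_self, List.drop_zero] at hp₁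
        rw [hocc.window_eq (List.prefix_refl _) (by simp only [List.length_append]; omega)
          le_rfl] at hp₂
        rw [List.take_of_length_le (by
          simp only [List.length_drop, List.length_append]; omega)] at hp₂
        exact hr.not_append_piece hC (List.take_append_drop _ r).symm hp₁ hp₂

theorem cleanAt_iff {u w X Y : List A} (hu : w ++ X ++ Y <+: u) :
    CleanAt R u w X Y ↔ ∀ p X₁ Y₁ Z₁, RelDecomp R X₁ Y₁ Z₁ → (w ++ X).length < p →
      p < (w ++ X ++ Y).length → ¬ OccursAt u p (X₁ ++ Y₁) := by
  constructor
  · intro h p X₁ Y₁ Z₁ hd hp₁ hp₂ hocc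
    simp only [List.length_append] at hp₁ hp₂
    have hlen : (Y.take (p - (w ++ X).length)).length = p - (w ++ X).length := by
      simp only [List.length_take, List.length_append]; omega
    refine h ⟨Y.take (p - (w ++ X).length), X₁, Y₁, Z₁, hd, ?_, List.take_prefix _ _, ?_, ?_⟩
    · intro h0
      rw [h0] at hlen
      simp only [List.length_nil, List.length_append] at hlen
      omega
    · intro h0
      rw [h0] at hlen
      simp only [List.length_append] at hlen
      omega
    · rw [List.append_assoc _ X₁]
      refine OccursAt.append_isPrefix (IsPrefix.trans ?_ hu) ?_
      · rw [List.prefix_append_right_inj]; exact List.take_prefix _ _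
      · rw [List.length_append, hlen]
        convert hocc using 1
        simp only [List.length_append]; omega
  · rintro h ⟨Y₀, X₁, Y₁, Z₁, hd, hne, hpre, hpr, hpu⟩
    have h0 := List.length_pos_of_ne_nil hne
    have h1 : Y₀.length < Y.length :=
      lt_of_le_of_ne hpre.length_le fun h => hpr (hpre.eq_of_length h)
    rw [List.append_assoc _ X₁] at hpu
    exact h _ X₁ Y₁ Z₁ hd (by simp only [List.length_append]; omega)
      (by simp only [List.length_append]; omega) (occursAt_of_isPrefix hpu)

/-- A relation word overlapping a clean overlap prefix is the obvious one. -/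
theorem CleanOverlapPrefix.eq_of_occursAt (hC : WeaklyC R 4) {u w X Y Z r : List A} {p : ℕ}
    (h : CleanOverlapPrefix R u w X Y Z) (hr : RelWord R r) (hocc : OccursAt u p r)
    (hp : p < (w ++ X ++ Y).length) : p = w.length ∧ r = X ++ Y ++ Z := by
  obtain ⟨hd, ho, hcl⟩ := h
  obtain ⟨b, hch, hb⟩ := ho.exists_chain hC hd
  have hu := ho.1
  rw [cleanAt_iff hu] at hcl
  rw [List.append_assoc] at hu
  have hXY := hd.length_lt hC
  have hg : X ++ Y <+: X ++ Y ++ Z := List.prefix_append _ _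
  have hwp : w.length ≤ p := by
    by_contra! hlt
    exact hch.not_occursAt hC hb hd hg hXY hu hlt hr hocc
  have ho := occursAt_of_isPrefix hu
  rcases hwp.eq_or_lt with rfl | hwp
  · refine ⟨rfl, ?_⟩
    by_cases hle : r.length ≤ (X ++ Y).length
    · exact (hr.eq_of_occursAt hC hd.1 hg hocc ho le_rfl (by omega)).1
    · exact (hd.eq_of_occursAt hr hg (List.prefix_refl _) ho hocc hXY le_rfl (by omega)).1.symm
  · exfalso
    simp only [List.length_append] at hp
    have hend : w.length + (X ++ Y).length < p + r.length := by
      by_contra! hle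
      have := (hr.eq_of_occursAt hC hd.1 hg hocc ho hwp.le hle).2
      omega
    simp only [List.length_append] at hend
    by_cases hpX : p ≤ (w ++ X).length
    · simp only [List.length_append] at hpX
      have hpc := piece_window (q := w.length + X.length)
        (e := w.length + (X.length + Y.length)) hr hd.1
        (List.prefix_refl _) hg hocc ho (Or.inr (by omega)) (by omega)
        (by omega) (by omega) (by simp only [List.length_append]; omega)
      rw [ho.window_eq hg (by omega) (by simp only [List.length_append]; omega)] at hpc
      apply hd.not_piece_middle hC
      convert hpc using 1
      simp [show w.length + (X.length + Y.length) - (w.length + X.length) = Y.length by omega]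
    · obtain ⟨X₀, Y₀, Z₀, rfl, hd₀⟩ := hr.exists_relDecomp hC
      exact hcl p X₀ Y₀ Z₀ hd₀ (by omega) (by simp only [List.length_append]; omega)
        (hocc.mono (List.prefix_append _ _))

/-- Every overlap prefix extends to a clean one along the chain. -/
theorem OverlapChain.exists_clean (hC : WeaklyC R 4) {u b : List A}
    (hb : NoneBefore R u b.length) (k : ℕ) :
    ∀ {w X Y Z : List A}, u.length - w.length ≤ k → OverlapChain R b w → RelDecomp R X Y Z →
      w ++ X ++ Y <+: u →
      ∃ w' X' Y' Z', w <+: w' ∧ CleanOverlapPrefix R u w' X' Y' Z' := by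
  induction k with
  | zero =>
    intro w X Y Z hk _ hd hu
    have h1 := hu.length_le
    have h2 := hd.length_lt hC
    simp only [List.length_append] at h1 h2
    omega
  | succ k ih =>
    intro w X Y Z hk hch hd hu
    by_cases hcl : CleanAt R u w X Y
    · exact ⟨w, X, Y, Z, List.prefix_refl _, hd, hch.oprefix hd hu hb, hcl⟩
    · obtain ⟨Y₀, X₁, Y₁, Z₁, hd₁, hne, hpre, hpr, hu₁⟩ := not_not.1 hcl
      have h0 := List.length_pos_of_ne_nil hne
      have h1 := hu.length_le
      have h2 := hd.length_lt hC
      obtain ⟨w', X', Y', Z', hw, hc⟩ := ih (by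
        simp only [List.length_append] at *; omega) (hch.step hd hne hpre hpr) hd₁ hu₁
      refine ⟨w', X', Y', Z', IsPrefix.trans ?_ hw, hc⟩
      rw [List.append_assoc]
      exact List.prefix_append _ _

/-- Rewriting the relation word of a clean overlap prefix in the obvious place. -/
theorem CleanOverlapPrefix.replace (hC : WeaklyC R 4) {w X Y Z X' Y' Z' t : List A}
    (h : CleanOverlapPrefix R (w ++ (X ++ Y ++ Z) ++ t) w X Y Z)
    (hd' : RelDecomp R X' Y' Z') :
    CleanOverlapPrefix R (w ++ (X' ++ Y' ++ Z') ++ t) w X' Y' Z' := by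
  classical
  obtain ⟨hd, ho, -⟩ := h
  obtain ⟨b, hch, hb⟩ := ho.exists_chain hC hd
  have hocc : OccursAt (w ++ (X' ++ Y' ++ Z') ++ t) w.length (X' ++ Y' ++ Z') :=
    occursAt_of_eq rfl
  have hpre : w ++ X' ++ Y' <+: w ++ (X' ++ Y' ++ Z') ++ t := by simp
  have hXY := hd'.length_lt hC
  refine ⟨hd', ?_, ?_⟩
  · by_cases hb' : NoneBefore R (w ++ (X' ++ Y' ++ Z') ++ t) b.length
    · exact hch.oprefix hd' hpre hb'
    · have hex : ∃ c, ∃ X₀ Y₀ Z₀, RelDecomp R X₀ Y₀ Z₀ ∧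
          OccursAt (w ++ (X' ++ Y' ++ Z') ++ t) c (X₀ ++ Y₀) := by
        by_contra hno
        exact hb' fun c X₀ Y₀ Z₀ h₁ h₂ => (hno ⟨c, X₀, Y₀, Z₀, h₁, h₂⟩).elim
      obtain ⟨X₀, Y₀, Z₀, hd₀, hc⟩ := Nat.find_spec hex
      have hmin : NoneBefore R (w ++ (X' ++ Y' ++ Z') ++ t) (Nat.find hex) :=
        fun c X₁ Y₁ Z₁ h₁ h₂ => Nat.find_min' hex ⟨X₁, Y₁, Z₁, h₁, h₂⟩
      generalize Nat.find hex = c at hc hmin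
      have hcb : c < b.length := by
        by_contra! hle
        exact hb' fun c' X₁ Y₁ Z₁ h₁ h₂ => hle.trans (hmin c' X₁ Y₁ Z₁ h₁ h₂)
      have hbw := hch.isPrefix.length_le
      have hend₁ : w.length < c + (X₀ ++ Y₀).length := by
        by_contra! hle
        have := hb c X₀ Y₀ Z₀ hd₀ (hc.of_common_isPrefix (c := w)
          (by simp) (by simp) hle)
        omega
      have hend₂ : c + (X₀ ++ Y₀).length < w.length + (X' ++ Y').length := by
        by_contra! hle
        have := hd'.eq_of_occursAt hd₀.1 (List.prefix_append _ _) (List.prefix_append _ _)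
          (hocc.mono (List.prefix_append _ _)) hc hXY (by omega) hle
        omega
      have hwb : w = b := by
        rcases hch.first with hwb | ⟨X₁, Y₁, Z₁, Y₁', hd₁, hne₁, hpre₁, hw₁⟩
        · exact hwb
        · exfalso
          have h0 := List.length_pos_of_ne_nil hne₁
          have h1 := hw₁.length_le
          have := hd₁.eq_of_occursAt hd₀.1 (g₁ := X₁ ++ Y₁')
            (by rw [List.append_assoc, List.prefix_append_right_inj]
                exact hpre₁.trans (List.prefix_append _ _))
            (List.prefix_append _ _) (occursAt_of_isPrefix
              (hw₁.trans (by simp)))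
            hc (by simp; omega) hcb.le (by simp only [List.length_append] at *; omega)
          omega
      subst hwb
      have hY₀ : c + X₀.length < w.length := by
        by_contra! hle
        simp only [List.length_append] at hend₂
        have hpc := piece_window (q := c + X₀.length) (e := c + (X₀ ++ Y₀).length)
          hd₀.1 hd'.1 (List.prefix_append _ _) (List.prefix_refl _) hc hocc
          (Or.inr (by omega)) (by omega) hle le_rfl
          (by simp only [List.length_append]; omega)
        rw [hc.window_eq (List.prefix_refl _) (by omega) le_rfl] at hpc
        apply hd₀.not_piece_middle hC
        convert hpc using 1
        simp [show c + (X₀.length + Y₀.length) - (c + X₀.length) = Y₀.length by omega]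
      simp only [List.length_append] at hend₁
      set Y₁ := Y₀.take (w.length - c - X₀.length) with hY₁
      have hlen : Y₁.length = w.length - c - X₀.length := by
        rw [hY₁, List.length_take]; omega
      have hw : w = w.take c ++ X₀ ++ Y₁ := by
        have h1 : OccursAt (w ++ (X' ++ Y' ++ Z') ++ t) c (X₀ ++ Y₁) := by
          refine hc.mono ?_
          rw [List.prefix_append_right_inj]
          exact List.take_prefix _ _
        have h2 : X₀ ++ Y₁ <+: w.drop c :=
          h1.of_common_isPrefix (c := w) (by simp) (List.prefix_refl _)
            (by simp only [List.length_append]; omega)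
        have h3 := h2.eq_of_length (by
          simp only [List.length_append, List.length_drop]; omega)
        rw [List.append_assoc, h3, List.take_append_drop]
      have hch' : OverlapChain R (w.take c) w := by
        have h1 : OverlapChain R (w.take c) (w.take c ++ X₀ ++ Y₁) := by
          refine OverlapChain.base.step hd₀ ?_ (List.take_prefix _ _) ?_
          · intro h0
            rw [h0, List.length_nil] at hlen
            omega
          · intro h0
            rw [h0] at hlen
            omega
        rwa [← hw] at h1
      refine hch'.oprefix hd' hpre ?_
      rwa [List.length_take, min_eq_left (by omega)]
  · rw [cleanAt_iff hpre]
    intro p X₁ Y₁ Z₁ hd₁ hp₁ hp₂ hocc₁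
    have hend : w.length + (X' ++ Y' ++ Z').length < p + (X₁ ++ Y₁).length := by
      by_contra! hle
      have := hd₁.eq_of_occursAt hd'.1 (List.prefix_append _ _) (List.prefix_refl _) hocc₁
        hocc (hd₁.length_lt hC) (by simp only [List.length_append] at *; omega) hle
      simp only [List.length_append] at *
      omega
    simp only [List.length_append] at hp₁ hp₂
    have hpc := piece_window (q := p) (e := w.length + (X' ++ Y' ++ Z').length) hd'.1 hd₁.1
      (List.prefix_refl _) (List.prefix_append _ _) hocc hocc₁ (Or.inr (by omega))
      (by omega) le_rfl le_rfl hend.le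
    rw [hocc.window_eq (List.prefix_refl _) (by omega) le_rfl, List.take_of_length_le (by
      simp only [List.length_drop, List.length_append]; omega)] at hpc
    have := hd'.2.2.2.2 _ (List.drop_suffix _ _) hpc
    simp only [List.length_drop, List.length_append] at this
    omega

/-- After a rewriting step beyond a clean overlap prefix, that prefix remains clean unless
it is contained in the initial part `w'` of a longer clean overlap prefix. -/
theorem CleanOverlapPrefix.rewrite_right (hC : WeaklyC R 4) {w X Y Z q x y t : List A}
    (h : CleanOverlapPrefix R (w ++ X ++ Y ++ q ++ x ++ t) w X Y Z) (hy : RelWord R y) :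
    OPrefix R (w ++ X ++ Y ++ q ++ y ++ t) w X Y ∧
      (CleanAt R (w ++ X ++ Y ++ q ++ y ++ t) w X Y ∨
        ∃ w' X' Y' Z', w ++ X ++ Y <+: w' ∧
          CleanOverlapPrefix R (w ++ X ++ Y ++ q ++ y ++ t) w' X' Y' Z') := by
  obtain ⟨hd, ho, hcl⟩ := h
  obtain ⟨b, hch, hb⟩ := ho.exists_chain hC hd
  have hu := ho.1
  rw [cleanAt_iff hu] at hcl
  set v := w ++ X ++ Y ++ q ++ y ++ t with hv
  have hpre : w ++ X ++ Y <+: v := by simp [hv]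
  have hcu : w ++ X ++ Y ++ q <+: w ++ X ++ Y ++ q ++ x ++ t := by simp
  have hcv : w ++ X ++ Y ++ q <+: v := by simp [hv]
  have hbw := hch.isPrefix.length_le
  have hXY := hd.length_lt hC
  have hb' : NoneBefore R v b.length := by
    intro c X₀ Y₀ Z₀ hd₀ hc
    by_contra! hlt
    by_cases hle : c + (X₀ ++ Y₀).length ≤ (w ++ X ++ Y).length
    · have := hb c X₀ Y₀ Z₀ hd₀ (hc.of_common_isPrefix hpre hu hle)
      omega
    · have := hd.eq_of_occursAt hd₀.1 (List.prefix_append _ _) (List.prefix_append _ _)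
        (occursAt_of_isPrefix (by rwa [← List.append_assoc])) hc hXY (by omega)
        (by simp only [List.length_append] at *; omega)
      omega
  refine ⟨hch.oprefix hd hpre hb', or_iff_not_imp_left.2 fun hncl => ?_⟩
  obtain ⟨Y₀, X₁, Y₁, Z₁, hd₁, hne, hpre₀, hpr, hu₁⟩ := not_not.1 hncl
  have h0 := List.length_pos_of_ne_nil hne
  have hlt₀ : Y₀.length < Y.length :=
    lt_of_le_of_ne hpre₀.length_le fun h => hpr (hpre₀.eq_of_length h)
  have hocc₁ : OccursAt v (w ++ X ++ Y₀).length (X₁ ++ Y₁) :=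
    occursAt_of_isPrefix (by rwa [← List.append_assoc])
  have hoccy : OccursAt v (w ++ X ++ Y ++ q).length y := occursAt_of_eq hv
  have hend₁ : (w ++ X ++ Y ++ q).length < (w ++ X ++ Y₀).length + (X₁ ++ Y₁).length := by
    by_contra! hle
    refine hcl _ X₁ Y₁ Z₁ hd₁ ?_ ?_ (hocc₁.of_common_isPrefix hcv hcu hle)
    all_goals simp only [List.length_append]; omega
  have hend₂ : (w ++ X ++ Y₀).length + (X₁ ++ Y₁).length <
      (w ++ X ++ Y ++ q).length + y.length := by
    by_contra! hle
    have := (hy.eq_of_occursAt hC hd₁.1 (List.prefix_append _ _) hoccy hocc₁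
      (by simp only [List.length_append]; omega) hle).2
    simp only [List.length_append] at this
    omega
  have hlen₁ : (w ++ X ++ Y₀).length + X₁.length < (w ++ X ++ Y ++ q).length := by
    by_contra! hle
    have hpc := piece_window (q := (w ++ X ++ Y₀).length + X₁.length)
      (e := (w ++ X ++ Y₀).length + (X₁ ++ Y₁).length) hd₁.1 hy (List.prefix_append _ _)
      (List.prefix_refl _) hocc₁ hoccy
      (Or.inr (by simp only [List.length_append]; omega)) (by omega) hle le_rfl hend₂.le
    rw [hocc₁.window_eq (List.prefix_refl _) (by omega) le_rfl] at hpc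
    apply hd₁.not_piece_middle hC
    convert hpc using 1
    rw [show (w ++ X ++ Y₀).length + (X₁ ++ Y₁).length - ((w ++ X ++ Y₀).length + X₁.length)
      = Y₁.length by simp only [List.length_append]; omega]
    simp
  set k := (w ++ X ++ Y ++ q).length - ((w ++ X ++ Y₀).length + X₁.length) with hk
  simp only [List.length_append] at hend₁ hlen₁ hk
  have hlen : (Y₁.take k).length = k := by rw [List.length_take]; omega
  have hchain : OverlapChain R b (w ++ X ++ Y₀ ++ X₁ ++ Y₁.take k) := by
    refine (hch.step hd hne hpre₀ hpr).step hd₁ ?_ (List.take_prefix _ _) ?_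
    · intro h0
      rw [h0, List.length_nil] at hlen
      omega
    · intro h0
      rw [h0] at hlen
      omega
  have heq : w ++ X ++ Y₀ ++ X₁ ++ Y₁.take k = w ++ X ++ Y ++ q := by
    have h1 : w ++ X ++ Y₀ ++ X₁ ++ Y₁.take k <+: v :=
      IsPrefix.trans (by rw [List.prefix_append_right_inj]; exact List.take_prefix _ _) hu₁
    refine (List.prefix_of_prefix_length_le h1 hcv ?_).eq_of_length ?_
    all_goals simp only [List.length_append, hlen]; omega
  rw [heq] at hchain
  obtain ⟨X₂, Y₂, Z₂, rfl, hd₂⟩ := hy.exists_relDecomp hC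
  obtain ⟨w', X', Y', Z', hw', hc'⟩ := OverlapChain.exists_clean hC hb' v.length
    (Nat.sub_le _ _) hchain hd₂ (by simp [hv])
  exact ⟨w', X', Y', Z', (List.prefix_append _ _).trans hw', hc'⟩

theorem relWord_of_mem {x y : List A} (h : (x, y) ∈ R ∨ (y, x) ∈ R) : RelWord R x := by
  rcases h with h | h
  · exact ⟨_, h, Or.inl rfl⟩
  · exact ⟨_, h, Or.inr rfl⟩

theorem OPrefix.of_isPrefix {u v w X Y : List A} (h : OPrefix R u w X Y)
    (hv : w ++ X ++ Y <+: v) : OPrefix R v w X Y :=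
  ⟨hv, h.2⟩

end Pieces

/-- Lemma 5: for a weakly `C(4)` finite monoid presentation, suppose
`u` has clean overlap prefix `w ++ X ++ Y` (with `X ++ Y ++ Z` a relation word factored
into maximal piece prefix, middle word and maximal piece suffix).  If `u ≡ v` then `v`
has overlap prefix `w ++ X' ++ Y'` for some complement `X' ++ Y' ++ Z'` of
`X ++ Y ++ Z`, and no relation word occurring as a factor of `v` overlaps this prefix,
unless it is `X' ++ Y' ++ Z'` in the obvious place. -/
theorem cleanOverlapPrefix_equiv {A : Type*} [Fintype A] [DecidableEq A]
    (R : Finset (List A × List A)) (hC : WeaklyC R 4)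
    (u w X Y Z v : List A)
    (hclean : CleanOverlapPrefix R u w X Y Z)
    (hequiv : MEquiv R u v) :
    ∃ X' Y' Z', RelComplement R (X ++ Y ++ Z) (X' ++ Y' ++ Z') ∧
      RelDecomp R X' Y' Z' ∧ OPrefix R v w X' Y' ∧
      ∀ s r t, v = s ++ r ++ t → RelWord R r →
        s.length < (w ++ X' ++ Y').length → s = w ∧ r = X' ++ Y' ++ Z' := by
  have eq_of : ∀ {v s w r r' : List A} {t : List A}, v = s ++ r ++ t → w <+: v →
      s.length = w.length → r = r' → s = w ∧ r = r' := by
    intro v s w r r' t hv hw hl hr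
    refine ⟨?_, hr⟩
    rw [hv, List.append_assoc] at hw
    exact ((List.prefix_of_prefix_length_le hw (List.prefix_append _ _) hl.ge).eq_of_length
      hl.symm).symm
  unfold MEquiv at hequiv
  induction hequiv using Relation.ReflTransGen.head_induction_on generalizing w X Y Z with
  | refl =>
    refine ⟨X, Y, Z, ⟨hclean.1.1, .refl⟩, hclean.1, hclean.2.1, fun s r t hv hr hs => ?_⟩
    obtain ⟨h1, h2⟩ := hclean.eq_of_occursAt hC hr (occursAt_of_eq hv) hs
    refine eq_of hv (IsPrefix.trans ?_ hclean.2.1.1) h1 h2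
    simp
  | @head u u₁ hstep _ ih =>
    obtain ⟨l, t, x, y, hxy, rfl, rfl⟩ := hstep
    have hx := relWord_of_mem hxy
    have hy := relWord_of_mem hxy.symm
    by_cases hl : l.length < (w ++ X ++ Y).length
    · obtain ⟨h1, h2⟩ := hclean.eq_of_occursAt hC hx (occursAt_of_eq rfl) hl
      obtain ⟨rfl, rfl⟩ := eq_of rfl (IsPrefix.trans (by simp) hclean.2.1.1) h1 h2
      obtain ⟨X₁, Y₁, Z₁, rfl, hd₁⟩ := hy.exists_relDecomp hC
      obtain ⟨X', Y', Z', hcomp, hrest⟩ := ih l X₁ Y₁ Z₁ (hclean.replace hC hd₁)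
      exact ⟨X', Y', Z', ⟨hx, .head hxy hcomp.2⟩, hrest⟩
    · have hwl : w ++ X ++ Y <+: l := by
        have h1 := hclean.2.1.1
        rw [List.append_assoc l] at h1
        exact List.prefix_of_prefix_length_le h1 (List.prefix_append _ _) (not_lt.1 hl)
      obtain ⟨q, rfl⟩ := hwl
      obtain ⟨ho, hcl | ⟨w', X', Y', Z', hw', hc'⟩⟩ := hclean.rewrite_right hC hy
      · exact ih w X Y Z ⟨hclean.1, ho, hcl⟩
      · obtain ⟨X₂, Y₂, Z₂, -, -, ho₂, hno⟩ := ih w' X' Y' Z' hc'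
        have hwv : w ++ X ++ Y <+: v :=
          hw'.trans (IsPrefix.trans (by simp) ho₂.1)
        refine ⟨X, Y, Z, ⟨hclean.1.1, .refl⟩, hclean.1, ho.of_isPrefix hwv,
          fun s r t' hv hr hs => ?_⟩
        have hlw := hw'.length_le
        have hsw := (hno s r t' hv hr (by
          rw [List.append_assoc, List.length_append]; omega)).1
        rw [hsw] at hs
        omega
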